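/- Let p be a prime with p ≡ 5 (mod 6), and let f(x,y) be a primitive binary cubic form with coefficients in ℤ_p. Then there exist x, y ∈ ℤ_p with f(x,y) = 1. -/

import Mathlib

open Finset

/-- Evaluation of the binary form of degree `n` with coefficient vector `c` at `(x, y)`:
`c 0 * x^n + c 1 * x^(n-1) * y + ⋯ + c n * y^n`. -/
def binEval {n : ℕ} {R : Type*} [CommRing R] (c : Fin (n + 1) → R) (x y : R) : R :=
  ∑ i : Fin (n + 1), c i * x ^ (n - (i : ℕ)) * y ^ (i : ℕ)

/-- The binary form with coefficient vector `c` as an element of `MvPolynomial (Fin 2) R`. -/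
noncomputable def formPolyR {n : ℕ} {R : Type*} [CommRing R] (c : Fin (n + 1) → R) :
    MvPolynomial (Fin 2) R :=
  ∑ i : Fin (n + 1), MvPolynomial.C (c i) * MvPolynomial.X 0 ^ (n - (i : ℕ)) *
    MvPolynomial.X 1 ^ (i : ℕ)

/-- The binary form with integer coefficient vector `c`, base-changed to `R`. -/
noncomputable def formPoly {n : ℕ} (R : Type*) [CommRing R] (c : Fin (n + 1) → ℤ) :
    MvPolynomial (Fin 2) R :=
  formPolyR (fun i => ((c i : R)))

/-- `F(X, 1)` over `R`, for the binary form with integer coefficient vector `c`. -/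
noncomputable def formPolyX {n : ℕ} (R : Type*) [CommRing R] (c : Fin (n + 1) → ℤ) :
    Polynomial R :=
  ∑ i : Fin (n + 1), Polynomial.C ((c i : R)) * Polynomial.X ^ (n - (i : ℕ))

/-- `IsDisc c D`: the binary form with coefficient vector `c` factors over `ℂ` as
`∏ (αᵢ x - βᵢ y)` and `D = ∏_{i<j} (αᵢ βⱼ - αⱼ βᵢ)²` is its discriminant. -/
def IsDisc {n : ℕ} (c : Fin (n + 1) → ℤ) (D : ℤ) : Prop :=
  ∃ α β : Fin n → ℂ,
    (∀ x y : ℂ, binEval (fun i => ((c i : ℂ))) x y = ∏ i : Fin n, (α i * x - β i * y)) ∧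
    (D : ℂ) = ∏ i : Fin n, ∏ j ∈ Finset.univ.filter (fun j => i < j),
      (α i * β j - α j * β i) ^ 2

/-- `G` is a maximal form: it is not a proper subform of any integral binary form. -/
def IsMaximalForm {n : ℕ} (G : Fin (n + 1) → ℤ) : Prop :=
  ¬ ∃ (F : Fin (n + 1) → ℤ) (a b c d : ℤ), 1 < |a * d - b * c| ∧
      ∀ x y : ℤ, binEval G x y = binEval F (a * x + b * y) (c * x + d * y)

/-- `GL₂(ℤ)`-equivalence of integral binary forms. -/
def FormEquiv {n : ℕ} (F G : Fin (n + 1) → ℤ) : Prop :=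
  ∃ a b c d : ℤ, |a * d - b * c| = 1 ∧
    ∀ x y : ℤ, binEval G x y = binEval F (a * x + b * y) (c * x + d * y)

/-- The form locally represents `h` everywhere: over `ℝ` and over `ℤ_p` for all primes `p`. -/
def LocallyRep {n : ℕ} (c : Fin (n + 1) → ℤ) (h : ℤ) : Prop :=
  (∃ x y : ℝ, binEval (fun i => ((c i : ℝ))) x y = (h : ℝ)) ∧
  ∀ (p : ℕ) (hp : p.Prime),
    haveI : Fact p.Prime := ⟨hp⟩
    ∃ x y : ℤ_[p], binEval (fun i => ((c i : ℤ_[p]))) x y = (h : ℤ_[p])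

/-- The integral binary form is primitive: the gcd of its coefficients is 1. -/
def IsPrimitiveForm {n : ℕ} (c : Fin (n + 1) → ℤ) : Prop :=
  ∀ d : ℤ, (∀ i, d ∣ c i) → IsUnit d

/-- The form splits completely modulo `p`: modulo `p` it is a product of pairwise
non-proportional linear forms over `ℤ/pℤ`. -/
def SplitsCompletelyMod (p : ℕ) {n : ℕ} (c : Fin (n + 1) → ℤ) : Prop :=
  ∃ L : Fin n → ZMod p × ZMod p,
    (∀ i j, i ≠ j → (L i).1 * (L j).2 ≠ (L j).1 * (L i).2) ∧
    formPoly (ZMod p) c =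
      ∏ i : Fin n, (MvPolynomial.C (L i).1 * MvPolynomial.X 0 +
        MvPolynomial.C (L i).2 * MvPolynomial.X 1)

/-- For a prime `p ≡ 2 (mod 3)`, every unit of `ℤ_p` is a cube. -/
theorem PadicInt.exists_pow_three_eq_of_isUnit {p : ℕ} [Fact p.Prime] (hp : p % 3 = 2)
    {u : ℤ_[p]} (hu : IsUnit u) : ∃ v : ℤ_[p], v ^ 3 = u := by
  obtain ⟨k, hk⟩ : ∃ k, k * 3 = (p - 1) + (p - 1) + 1 := ⟨(2 * p - 1) / 3, by omega⟩
  have hdvd : (p : ℤ_[p]) ∣ (u ^ k) ^ 3 - u := by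
    rw [← Ideal.mem_span_singleton, ← PadicInt.maximalIdeal_eq_span_p, ← PadicInt.ker_toZMod,
      RingHom.mem_ker]
    have h1 : PadicInt.toZMod u ^ (p - 1) = 1 :=
      ZMod.pow_card_sub_one_eq_one (hu.map PadicInt.toZMod).ne_zero
    rw [← pow_mul, hk, map_sub, map_pow, pow_succ, pow_add, h1]
    ring
  have h3 : ‖(3 : ℤ_[p])‖ = 1 := by
    have : ‖((3 : ℕ) : ℤ_[p])‖ = 1 := by
      rw [PadicInt.norm_natCast_eq_one_iff]
      refine (Nat.coprime_primes Fact.out Nat.prime_three).2 ?_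
      rintro rfl
      omega
    exact_mod_cast this
  have hnorm : ‖(Polynomial.X ^ 3 - Polynomial.C u : Polynomial ℤ_[p]).aeval (u ^ k)‖ <
      ‖(Polynomial.X ^ 3 - Polynomial.C u : Polynomial ℤ_[p]).derivative.aeval (u ^ k)‖ ^ 2 := by
    have h3' : ‖(2 + 1 : ℤ_[p])‖ = 1 := by rwa [two_add_one_eq_three]
    simpa [h3', PadicInt.isUnit_iff.1 hu] using (PadicInt.norm_lt_one_iff_dvd _).2 hdvd
  obtain ⟨v, hv, -⟩ := hensels_lemma hnorm
  exact ⟨v, by simpa [sub_eq_zero] using hv⟩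

/-- If `π` is a prime element not dividing `2`, a binary cubic form takes a value not divisible by
`π` unless all its coefficients are divisible by `π`. -/
theorem exists_not_dvd_binEval_cubic {R : Type*} [CommRing R] {π : R} (hπ : Prime π)
    (h2 : ¬ π ∣ 2) {c : Fin 4 → R} (hc : ∃ i, ¬ π ∣ c i) :
    ∃ x y : R, ¬ π ∣ binEval c x y := by
  by_contra! h
  have h0 : π ∣ c 0 := by simpa [binEval, Fin.sum_univ_four] using h 1 0
  have h3 : π ∣ c 3 := by simpa [binEval, Fin.sum_univ_four] using h 0 1
  have hadd : π ∣ c 0 + c 1 + c 2 + c 3 := by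
    simpa [binEval, Fin.sum_univ_four] using h 1 1
  have hsub : π ∣ c 0 + -c 1 + c 2 + -c 3 := by
    have := h 1 (-1)
    rw [binEval, Fin.sum_univ_four] at this
    convert this using 1
    simp
    ring
  have h1 : π ∣ c 1 := by
    refine (hπ.dvd_or_dvd ?_).resolve_left h2
    have := (hadd.sub hsub).sub (h3.mul_left 2)
    convert this using 1
    ring
  have h2' : π ∣ c 2 := by
    have := hadd.sub ((h0.add h1).add h3)
    convert this using 1
    ring
  obtain ⟨i, hi⟩ := hc
  fin_cases i <;> contradiction

/-- Binary forms of degree `n` are homogeneous of degree `n`. -/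
theorem binEval_mul_mul {n : ℕ} {R : Type*} [CommRing R] (c : Fin (n + 1) → R) (t x y : R) :
    binEval c (t * x) (t * y) = t ^ n * binEval c x y := by
  rw [binEval, binEval, Finset.mul_sum]
  refine Finset.sum_congr rfl fun i _ => ?_
  have ht : t ^ n = t ^ (n - (i : ℕ)) * t ^ (i : ℕ) := by
    rw [← pow_add, Nat.sub_add_cancel (Nat.le_of_lt_succ i.isLt)]
  rw [ht, mul_pow, mul_pow]
  ring

/-- for `p ≡ 5 (mod 6)`, every primitive binary cubic form over `ℤ_p`
represents `1`. -/
theorem represents_one_five_mod_six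
    (p : ℕ) [Fact p.Prime] (hp6 : p % 6 = 5)
    (c : Fin 4 → ℤ_[p]) (hprim : ∃ i, ¬ (p : ℤ_[p]) ∣ c i) :
    ∃ x y : ℤ_[p], binEval c x y = 1 := by
  have h2 : ¬ (p : ℤ_[p]) ∣ 2 := by
    have := PadicInt.norm_int_lt_one_iff_dvd (p := p) 2
    rw [PadicInt.norm_lt_one_iff_dvd] at this
    intro h
    have := Int.le_of_dvd two_pos (this.1 (by exact_mod_cast h))
    omega
  obtain ⟨x, y, hxy⟩ := exists_not_dvd_binEval_cubic PadicInt.prime_p h2 hprim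
  have hu : IsUnit (binEval c x y) := by
    rwa [← PadicInt.norm_lt_one_iff_dvd, ← PadicInt.not_isUnit_iff, not_not] at hxy
  obtain ⟨w, hw⟩ := hu.exists_right_inv
  obtain ⟨t, ht⟩ := PadicInt.exists_pow_three_eq_of_isUnit (by omega) (.of_mul_eq_one_right _ hw)
  exact ⟨t * x, t * y, by rw [binEval_mul_mul, ht, mul_comm, hw]⟩
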